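/- arXiv:2010.03913 — 3 statements merged into one kernel-verified Lean document; each statement's English description precedes it below -/
import Mathlib

section
/- Let G be a topological group and F a topological space equipped with a continuous free multiplicative action of G such that the orbit space F/G, with the quotient topology, is discrete. Let X be a finite set. Then the set Fr(F) of bases of F indexed by X (i.e., {f : X → F | φ_f is bijective}) is both open and closed in the product space X → F. -/
/-- For a free action, a family `f` is a basis if and only if it meets every orbit exactly once. -/
theorem bijective_smul_iff_bijective_quotient_mk {G F X : Type*} [Group G] [MulAction G F]
    (hfree : ∀ (g : G) (a : F), g • a = a → g = 1) (f : X → F) :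
    Function.Bijective (fun p : G × X => p.1 • f p.2) ↔
      Function.Bijective
        (fun x => (Quotient.mk (MulAction.orbitRel G F) (f x))) := by
  constructor
  · rintro ⟨hinj, hsurj⟩
    refine ⟨fun x y hxy => ?_, fun b => ?_⟩
    · obtain ⟨g, hg⟩ := MulAction.orbitRel_apply.1 (Quotient.exact hxy)
      have h : (g, y) = ((1 : G), x) := hinj (by simpa using hg)
      exact (congrArg Prod.snd h).symm
    · induction b using Quotient.inductionOn with
      | _ a =>
        obtain ⟨⟨g, x⟩, hgx⟩ := hsurj a
        exact ⟨x, (Quotient.sound (MulAction.orbitRel_apply.2 ⟨g, hgx⟩)).symm⟩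
  · rintro ⟨hinj, hsurj⟩
    refine ⟨?_, fun a => ?_⟩
    · rintro ⟨g, x⟩ ⟨h, y⟩ hgh
      replace hgh : g • f x = h • f y := hgh
      obtain rfl : x = y := hinj <| Quotient.sound <| MulAction.orbitRel_apply.2
        ⟨g⁻¹ * h, by simp [mul_smul, ← hgh]⟩
      have h1 : h⁻¹ * g = 1 := hfree _ (f x) (by simp [mul_smul, hgh])
      rw [inv_mul_eq_one.1 h1]
    · obtain ⟨x, hx⟩ := hsurj (Quotient.mk _ a)
      obtain ⟨g, hg⟩ := MulAction.orbitRel_apply.1 (Quotient.exact hx.symm)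
      exact ⟨(g, x), hg⟩

/-- For a semi-torsor (free continuous action with discrete orbit space) and a
finite index set `X`, the set of bases indexed by `X` is open and closed in the
product space `X → F`. -/
theorem frame_set_isOpen_isClosed {G F X : Type} [Group G] [TopologicalSpace G]
    [IsTopologicalGroup G] [TopologicalSpace F] [MulAction G F]
    [ContinuousSMul G F] [Finite X]
    (hfree : ∀ (g : G) (a : F), g • a = a → g = 1)
    [DiscreteTopology (Quotient (MulAction.orbitRel G F))] :
    IsOpen {f : X → F | Function.Bijective (fun p : G × X => p.1 • f p.2)} ∧
    IsClosed {f : X → F | Function.Bijective (fun p : G × X => p.1 • f p.2)} := by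
  simp only [bijective_smul_iff_bijective_quotient_mk hfree]
  have hq : Continuous fun (f : X → F) x => Quotient.mk (MulAction.orbitRel G F) (f x) :=
    continuous_pi fun x => continuous_quotient_mk'.comp (continuous_apply x)
  exact (isClopen_discrete {b : X → Quotient (MulAction.orbitRel G F) |
    Function.Bijective b}).preimage hq |>.symm
end

section
/- Let F be a free G-set and let Aut_G(F) denote the group (under composition) of G-equivariant bijections of F. Every ψ ∈ Aut_G(F) descends to a unique bijection C_q(ψ) of the orbit space F/G satisfying q ∘ ψ = C_q(ψ) ∘ q, and the assignment ψ ↦ C_q(ψ) is a group homomorphism C_q : Aut_G(F) → Sym(F/G). Moreover, C_q is surjective, admits a group-homomorphism section s : Sym(F/G) → Aut_G(F) with C_q ∘ s = id, and its kernel is exactly the subgroup Aut(q) = {ψ ∈ Aut_G(F) | q ∘ ψ = q} of orbit-preserving automorphisms. -/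
/-- The group of G-equivariant bijections of a G-set, as a subgroup of `Equiv.Perm F`. -/
def autG (G F : Type) [Group G] [MulAction G F] : Subgroup (Equiv.Perm F) where
  carrier := {ψ | ∀ (g : G) (a : F), ψ (g • a) = g • ψ a}
  one_mem' := by intro g a; rfl
  mul_mem' := by
    intro ψ φ hψ hφ g a
    simp only [Equiv.Perm.mul_apply, hφ g a, hψ g (φ a)]
  inv_mem' := by
    intro ψ hψ g a
    apply ψ.injective
    change ψ (ψ.symm (g • a)) = ψ (g • ψ.symm a)
    rw [Equiv.apply_symm_apply, hψ, Equiv.apply_symm_apply]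

/-- The homomorphism sending an equivariant bijection to the permutation it induces on orbits. -/
def autGToOrbitPerm (G F : Type) [Group G] [MulAction G F] :
    autG G F →* Equiv.Perm (Quotient (MulAction.orbitRel G F)) where
  toFun ψ := Quotient.congr (ψ : Equiv.Perm F) fun a b => by
    change (∃ g : G, g • b = a) ↔ ∃ g : G, g • (ψ : Equiv.Perm F) b = (ψ : Equiv.Perm F) a
    refine exists_congr fun g => ?_
    rw [← ψ.2 g b, Equiv.apply_eq_iff_eq]
  map_one' := by
    ext x
    induction x using Quotient.inductionOn
    rfl
  map_mul' ψ φ := by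
    ext x
    induction x using Quotient.inductionOn
    rfl

theorem mk_smul_out {G F : Type} [Group G] [MulAction G F]
    (g : G) (x : Quotient (MulAction.orbitRel G F)) :
    Quotient.mk (MulAction.orbitRel G F) (g • x.out) = x :=
  (Quotient.sound (MulAction.mem_orbit x.out g)).trans x.out_eq

theorem bijective_smul_quotient_out {G F : Type} [Group G] [MulAction G F]
    (hfree : ∀ (g : G) (a : F), g • a = a → g = 1) :
    Function.Bijective
      fun p : G × Quotient (MulAction.orbitRel G F) => p.1 • p.2.out := by
  constructor
  · rintro ⟨g, x⟩ ⟨h, y⟩ hxy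
    change g • x.out = h • y.out at hxy
    obtain rfl : x = y := by rw [← mk_smul_out g x, hxy, mk_smul_out]
    have hgh : h⁻¹ * g = 1 := hfree _ x.out (by rw [mul_smul, hxy, inv_smul_smul])
    rw [inv_mul_eq_one.mp hgh]
  · intro a
    obtain ⟨g, hg⟩ :=
      Quotient.exact (Quotient.out_eq (Quotient.mk (MulAction.orbitRel G F) a)).symm
    exact ⟨(g, Quotient.mk _ a), hg⟩

/-- A free `G`-set is the product of `G` and its orbit space, by a choice of orbit
representatives. -/
noncomputable def prodOrbitsEquiv {G F : Type} [Group G] [MulAction G F]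
    (hfree : ∀ (g : G) (a : F), g • a = a → g = 1) :
    G × Quotient (MulAction.orbitRel G F) ≃ F :=
  Equiv.ofBijective _ (bijective_smul_quotient_out hfree)

theorem prodOrbitsEquiv_mul {G F : Type} [Group G] [MulAction G F]
    (hfree : ∀ (g : G) (a : F), g • a = a → g = 1)
    (g h : G) (x : Quotient (MulAction.orbitRel G F)) :
    prodOrbitsEquiv hfree (g * h, x) = g • prodOrbitsEquiv hfree (h, x) :=
  mul_smul g h x.out

theorem mk_prodOrbitsEquiv {G F : Type} [Group G] [MulAction G F]
    (hfree : ∀ (g : G) (a : F), g • a = a → g = 1)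
    (p : G × Quotient (MulAction.orbitRel G F)) :
    Quotient.mk (MulAction.orbitRel G F) (prodOrbitsEquiv hfree p) = p.2 :=
  mk_smul_out p.1 p.2

/-- The homomorphism lifting a permutation of the orbits of a free `G`-set to an equivariant
bijection, by a choice of orbit representatives. -/
noncomputable def orbitPermToAutG {G F : Type} [Group G] [MulAction G F]
    (hfree : ∀ (g : G) (a : F), g • a = a → g = 1) :
    Equiv.Perm (Quotient (MulAction.orbitRel G F)) →* autG G F where
  toFun σ := ⟨(prodOrbitsEquiv hfree).permCongr (Equiv.prodCongr (Equiv.refl G) σ), by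
    intro g a
    obtain ⟨⟨h, x⟩, rfl⟩ := (prodOrbitsEquiv hfree).surjective a
    rw [← prodOrbitsEquiv_mul]
    simp [Equiv.permCongr_apply, ← prodOrbitsEquiv_mul]⟩
  map_one' := by
    ext a
    simp [Equiv.permCongr_apply]
  map_mul' σ τ := by
    ext a
    simp [Equiv.permCongr_apply, Prod.map]

theorem autGToOrbitPerm_orbitPermToAutG {G F : Type} [Group G] [MulAction G F]
    (hfree : ∀ (g : G) (a : F), g • a = a → g = 1)
    (σ : Equiv.Perm (Quotient (MulAction.orbitRel G F))) :
    autGToOrbitPerm G F (orbitPermToAutG hfree σ) = σ := by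
  ext x
  induction x using Quotient.inductionOn with | _ a
  obtain ⟨p, rfl⟩ := (prodOrbitsEquiv hfree).surjective a
  change Quotient.mk _ ((prodOrbitsEquiv hfree).permCongr
    (Equiv.prodCongr (Equiv.refl G) σ) (prodOrbitsEquiv hfree p)) = _
  simp [Equiv.permCongr_apply, mk_prodOrbitsEquiv]

/-- Every G-equivariant bijection of a free G-set descends to a unique bijection
of the orbit space, this assignment is a group homomorphism `C_q` into
`Sym(F/G)`, which is surjective, admits a group-homomorphism section, and whose
kernel is exactly the orbit-preserving automorphisms. -/
theorem autG_descends_to_orbit_perm {G F : Type} [Group G] [MulAction G F]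
    (hfree : ∀ (g : G) (a : F), g • a = a → g = 1) :
    ∃ Cq : autG G F →* Equiv.Perm (Quotient (MulAction.orbitRel G F)),
      (∀ (ψ : autG G F) (a : F),
          Quotient.mk (MulAction.orbitRel G F) ((ψ : Equiv.Perm F) a) =
            Cq ψ (Quotient.mk (MulAction.orbitRel G F) a)) ∧
      (∀ (ψ : autG G F) (c : Equiv.Perm (Quotient (MulAction.orbitRel G F))),
          (∀ a : F, Quotient.mk (MulAction.orbitRel G F) ((ψ : Equiv.Perm F) a) =
            c (Quotient.mk (MulAction.orbitRel G F) a)) → c = Cq ψ) ∧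
      Function.Surjective Cq ∧
      (∃ s : Equiv.Perm (Quotient (MulAction.orbitRel G F)) →* autG G F,
          ∀ σ, Cq (s σ) = σ) ∧
      (∀ ψ : autG G F, Cq ψ = 1 ↔
          ∀ a : F, Quotient.mk (MulAction.orbitRel G F) ((ψ : Equiv.Perm F) a) =
            Quotient.mk (MulAction.orbitRel G F) a) := by
  have unique (ψ : autG G F) (c : Equiv.Perm (Quotient (MulAction.orbitRel G F)))
      (hc : ∀ a : F, Quotient.mk (MulAction.orbitRel G F) ((ψ : Equiv.Perm F) a) =
        c (Quotient.mk (MulAction.orbitRel G F) a)) : c = autGToOrbitPerm G F ψ := by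
    ext x
    induction x using Quotient.inductionOn with | _ a
    exact (hc a).symm
  refine ⟨autGToOrbitPerm G F, fun _ _ => rfl, unique,
    fun σ => ⟨_, autGToOrbitPerm_orbitPermToAutG hfree σ⟩,
    ⟨orbitPermToAutG hfree, autGToOrbitPerm_orbitPermToAutG hfree⟩, fun ψ => ⟨?_, ?_⟩⟩
  · intro hψ a
    exact DFunLike.congr_fun hψ (Quotient.mk (MulAction.orbitRel G F) a)
  · intro hψ
    exact (unique ψ 1 hψ).symm
end

section
/- Let G be a group and X a set, and equip G × X with the G-action g • (h, x) = (g·h, x). The map I sending a pair (g̃, σ), with g̃ : X → G and σ a bijection of X, to the transformation (h, x) ↦ (h · (g̃(σ(x)))⁻¹, σ(x)) is a group isomorphism from the wreath product G ≀ X = (X → G) ⋊ Sym(X) onto the group Aut_G(G × X) of G-equivariant bijections of G × X. -/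
/-- The action of `Sym(X)` on the product group `X → G` by precomposition with
the inverse permutation, as a homomorphism into `MulAut (X → G)`. This is the
twisting datum of the wreath product `G ≀ X = (X → G) ⋊ Sym(X)`. -/
def permMulAut (G X : Type) [Group G] : Equiv.Perm X →* MulAut (X → G) where
  toFun σ :=
    { toFun := fun gs => gs ∘ σ.symm
      invFun := fun gs => gs ∘ σ
      left_inv := fun gs => by funext x; simp
      right_inv := fun gs => by funext x; simp
      map_mul' := fun gs hs => rfl }
  map_one' := by ext gs x; rfl
  map_mul' σ τ := by ext gs x; rfl

/-- The group of G-equivariant bijections of `G × X`, where `G` acts by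
`g • (h, x) = (g * h, x)`, as a subgroup of `Equiv.Perm (G × X)`. -/
def autGX (G X : Type) [Group G] : Subgroup (Equiv.Perm (G × X)) where
  carrier := {ψ | ∀ (g : G) (p : G × X), ψ (g * p.1, p.2) = (g * (ψ p).1, (ψ p).2)}
  one_mem' := fun _ _ => rfl
  mul_mem' := by
    intro ψ φ hψ hφ g p
    simp only [Equiv.Perm.mul_apply]
    rw [hφ g p]
    exact hψ g (φ p)
  inv_mem' := by
    intro ψ hψ g p
    apply ψ.injective
    have h : ∀ q, ψ (ψ⁻¹ q) = q := fun q => ψ.apply_symm_apply q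
    rw [h, hψ g (ψ⁻¹ p), h]

theorem permMulAut_apply {G X : Type} [Group G] (σ : Equiv.Perm X) (gs : X → G) (x : X) :
    permMulAut G X σ gs x = gs (σ.symm x) :=
  rfl

/-- The equivariant bijection `(h, x) ↦ (h * (gs (σ x))⁻¹, σ x)` attached to an element
`(gs, σ)` of the wreath product. -/
def wreathPerm {G X : Type} [Group G] (w : (X → G) ⋊[permMulAut G X] Equiv.Perm X) :
    Equiv.Perm (G × X) where
  toFun p := (p.1 * (w.left (w.right p.2))⁻¹, w.right p.2)
  invFun p := (p.1 * w.left p.2, w.right.symm p.2)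
  left_inv p := by simp
  right_inv p := by simp

/-- The homomorphism from the wreath product to the equivariant bijections of `G × X`. -/
def wreathToAutGX (G X : Type) [Group G] :
    ((X → G) ⋊[permMulAut G X] Equiv.Perm X) →* autGX G X :=
  MonoidHom.mk' (fun w => ⟨wreathPerm w, fun g p => by simp [wreathPerm, mul_assoc]⟩) <| by
    intro v w
    ext p <;> simp [wreathPerm, permMulAut_apply, mul_assoc]

theorem wreathToAutGX_apply {G X : Type} [Group G]
    (w : (X → G) ⋊[permMulAut G X] Equiv.Perm X) (h : G) (x : X) :
    (wreathToAutGX G X w : Equiv.Perm (G × X)) (h, x) =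
      (h * (w.left (w.right x))⁻¹, w.right x) :=
  rfl

theorem wreathToAutGX_injective (G X : Type) [Group G] :
    Function.Injective (wreathToAutGX G X) := by
  intro v w hvw
  have key (x : X) := congrArg (fun ψ : autGX G X => (ψ : Equiv.Perm (G × X)) (1, x)) hvw
  simp only [wreathToAutGX_apply, Prod.mk.injEq, one_mul, inv_inj] at key
  have hright : v.right = w.right := Equiv.ext fun x => (key x).2
  refine SemidirectProduct.ext (funext fun y => ?_) hright
  simpa [hright] using (key (w.right.symm y)).1

/-- An equivariant bijection of `G × X` is determined by its values on `{1} × X`. -/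
theorem autGX_apply {G X : Type} [Group G] {ψ : Equiv.Perm (G × X)} (hψ : ψ ∈ autGX G X)
    (h : G) (x : X) : ψ (h, x) = (h * (ψ (1, x)).1, (ψ (1, x)).2) := by
  simpa using hψ h (1, x)

theorem autGX_snd_symm_apply {G X : Type} [Group G] {ψ : Equiv.Perm (G × X)}
    (hψ : ψ ∈ autGX G X) (x : X) : (ψ.symm (1, (ψ (1, x)).2)).2 = x := by
  have hsymm : ψ.symm ∈ autGX G X := inv_mem hψ
  have := autGX_apply hsymm (ψ (1, x)).1 (ψ (1, x)).2
  rw [Prod.mk.eta, Equiv.symm_apply_apply] at this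
  exact (congrArg Prod.snd this).symm

/-- The permutation of `X` induced by an equivariant bijection of `G × X`. -/
def autGXPerm {G X : Type} [Group G] (ψ : autGX G X) : Equiv.Perm X where
  toFun x := ((ψ : Equiv.Perm (G × X)) (1, x)).2
  invFun x := ((ψ : Equiv.Perm (G × X)).symm (1, x)).2
  left_inv x := autGX_snd_symm_apply ψ.2 x
  right_inv x := autGX_snd_symm_apply (inv_mem ψ.2) x

theorem wreathToAutGX_surjective (G X : Type) [Group G] :
    Function.Surjective (wreathToAutGX G X) := by
  intro ψ
  refine ⟨⟨fun y => ((ψ : Equiv.Perm (G × X)) (1, (autGXPerm ψ).symm y)).1⁻¹, autGXPerm ψ⟩, ?_⟩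
  refine Subtype.ext (Equiv.ext fun ⟨h, x⟩ => ?_)
  rw [wreathToAutGX_apply, autGX_apply ψ.2]
  simp only [Equiv.symm_apply_apply, inv_inv]
  rfl

/-- The wreath product `G ≀ X = (X → G) ⋊ Sym(X)` is isomorphic to the group of
G-equivariant bijections of the model free G-set `G × X`, via
`(gs, σ) ↦ ((h, x) ↦ (h * (gs (σ x))⁻¹, σ x))`. -/
theorem wreath_iso_autGX {G X : Type} [Group G] :
    ∃ e : ((X → G) ⋊[permMulAut G X] Equiv.Perm X) ≃* autGX G X,
      ∀ (w : (X → G) ⋊[permMulAut G X] Equiv.Perm X) (h : G) (x : X),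
        ((e w : Equiv.Perm (G × X)) (h, x)) =
          (h * (w.left (w.right x))⁻¹, w.right x) := by
  exact ⟨MulEquiv.ofBijective (wreathToAutGX G X)
    ⟨wreathToAutGX_injective G X, wreathToAutGX_surjective G X⟩, wreathToAutGX_apply⟩
end
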